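/- For every even integer k ≥ 2, ⟨L_k, L_{k−1}⟩₁ = 0. -/

import Mathlib

open MeasureTheory Polynomial Set

noncomputable section

/-- The weight `w(x) = e^{−Mx/2}·x^{(M−N−1)/2}·(t−x)^{−1/2}` on `(0,∞)`,
using the principal branch of the complex power. -/
def wC (M N : ℕ) (t : ℂ) (x : ℝ) : ℂ :=
  Complex.exp (-(M : ℂ) * x / 2) * (x : ℂ) ^ (((((M : ℝ) - N - 1) / 2 : ℝ)) : ℂ) *
    (t - x) ^ (-(1 / 2) : ℂ)

/-- The Laguerre weight `w₀(x) = x^{M−N}·e^{−Mx}`. -/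
def w0R (M N : ℕ) (x : ℝ) : ℝ := x ^ (M - N) * Real.exp (-(M : ℝ) * x)

/-- The skew product `⟨f,g⟩₁ = ∫₀^∞∫₀^∞ (1/2)·sgn(x−y)·f(x)·g(y)·w(x)·w(y) dy dx`. -/
def skew1 (M N : ℕ) (t : ℂ) (f g : Polynomial ℂ) : ℂ :=
  ∫ x in Ioi (0 : ℝ), ∫ y in Ioi (0 : ℝ),
    ((Real.sign (x - y) : ℝ) : ℂ) / 2 * f.eval (x : ℂ) * g.eval (y : ℂ) *
      wC M N t x * wC M N t y

/-- The inner product `⟨f,g⟩₂ = ∫₀^∞ f(x)·g(x)·w₀(x) dx`. -/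
def inner2C (M N : ℕ) (f g : Polynomial ℂ) : ℂ :=
  ∫ x in Ioi (0 : ℝ), f.eval (x : ℂ) * g.eval (x : ℂ) * (w0R M N x : ℂ)

/-- `IsLag M N L` says that `L n` is the monic degree-`n` orthogonal polynomial for the
weight `w₀` (the rescaled Laguerre polynomial). -/
def IsLag (M N : ℕ) (L : ℕ → Polynomial ℂ) : Prop :=
  ∀ n, (L n).Monic ∧ (L n).natDegree = n ∧
    ∀ j, j < n → inner2C M N (L n) (Polynomial.X ^ j) = 0

/-- The operator `T(q)(x) = x(t−x)q′(x) +
[(t−2x) − (M/2)x(t−x) + ((M−N−1)/2)(t−x) + x/2]·q(x)`,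
i.e. formally `T(q) = (d/dx)(q·x·(t−x)·w)/w`. -/
def Tq (M N : ℕ) (t : ℂ) (q : Polynomial ℂ) : Polynomial ℂ :=
  Polynomial.X * (Polynomial.C t - Polynomial.X) * Polynomial.derivative q +
    ((Polynomial.C t - 2 * Polynomial.X)
        - Polynomial.C ((M : ℂ) / 2) * (Polynomial.X * (Polynomial.C t - Polynomial.X))
        + Polynomial.C (((M : ℂ) - N - 1) / 2) * (Polynomial.C t - Polynomial.X)
        + Polynomial.C (1 / 2) * Polynomial.X) * q

/-- `ε(f)(x) = ∫₀^∞ (1/2)·sgn(x−y)·f(y) dy`. -/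
def epsC (f : ℝ → ℂ) (x : ℝ) : ℂ :=
  ∫ y in Ioi (0 : ℝ), ((Real.sign (x - y) : ℝ) : ℂ) / 2 * f y

/-- The squared norm `h_{n,0} = ∫₀^∞ L_n(x)²·w₀(x) dx`. -/
def hC (M N : ℕ) (L : ℕ → Polynomial ℂ) (n : ℕ) : ℂ :=
  ∫ x in Ioi (0 : ℝ), (L n).eval (x : ℂ) ^ 2 * (w0R M N x : ℂ)

end

lemma integrableOn_eval_mul_rpow_mul_exp (p : ℂ[X]) {s c : ℝ} (hs : 0 ≤ s) (hc : 0 < c) :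
    IntegrableOn (fun x : ℝ => p.eval (x : ℂ) * ((x ^ s * Real.exp (-c * x) : ℝ) : ℂ))
      (Ioi 0) := by
  induction p using Polynomial.induction_on' with
  | add p q hp hq =>
    refine (hp.add hq).congr_fun (fun x _ => ?_) measurableSet_Ioi
    simp only [Pi.add_apply, eval_add, add_mul]
  | monomial n a =>
    have h := integrableOn_rpow_mul_exp_neg_mul_rpow (p := 1) (s := n + s) (b := c)
      (neg_one_lt_zero.trans_le (by positivity)) one_pos hc
    refine IntegrableOn.congr_fun (h.ofReal.const_mul a) (fun x hx => ?_) measurableSet_Ioi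
    have hx' : (0 : ℝ) < x := hx
    change a * ((x ^ ((n : ℝ) + s) * Real.exp (-c * x ^ (1 : ℝ)) : ℝ) : ℂ) = _
    simp only [eval_monomial, Real.rpow_one, Real.rpow_add hx', Real.rpow_natCast]
    simp only [Complex.ofReal_mul, Complex.ofReal_pow]
    ring

lemma integrableOn_eval_mul_w0R {M N : ℕ} (hM : 0 < M) (p : ℂ[X]) :
    IntegrableOn (fun x : ℝ => p.eval (x : ℂ) * (w0R M N x : ℂ)) (Ioi 0) := by
  refine (integrableOn_eval_mul_rpow_mul_exp p (s := (M - N : ℕ)) (c := M) (by positivity)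
    (by positivity)).congr_fun (fun x _ => ?_) measurableSet_Ioi
  simp only [w0R, Real.rpow_natCast]

lemma sub_ofReal_mem_slitPlane {t : ℂ} (ht : t.im ≠ 0) (x : ℝ) :
    t - x ∈ Complex.slitPlane :=
  Or.inr (by simpa using ht)

lemma norm_sub_cpow_neg_half_le {t : ℂ} (ht : t.im ≠ 0) (x : ℝ) :
    ‖(t - x) ^ (-(1 / 2) : ℂ)‖ ≤ |t.im| ^ (-(1 / 2) : ℝ) := by
  have h : (-(1 / 2) : ℂ) = ((-(1 / 2) : ℝ) : ℂ) := by push_cast; rfl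
  rw [h, Complex.norm_cpow_real]
  refine Real.rpow_le_rpow_of_nonpos (abs_pos.2 ht) ?_ (by norm_num)
  simpa using Complex.abs_im_le_norm (t - x)

lemma continuous_sub_cpow {t : ℂ} (ht : t.im ≠ 0) (r : ℂ) :
    Continuous fun x : ℝ => (t - x) ^ r :=
  (by fun_prop : Continuous fun x : ℝ => t - (x : ℂ)).cpow continuous_const
    (sub_ofReal_mem_slitPlane ht)

lemma integrableOn_eval_mul_wC {M N : ℕ} (hNM : N < M) {t : ℂ} (ht : t.im ≠ 0) (p : ℂ[X]) :
    IntegrableOn (fun x : ℝ => p.eval (x : ℂ) * wC M N t x) (Ioi 0) := by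
  have hM : (0 : ℝ) < M := by exact_mod_cast (Nat.zero_le N).trans_lt hNM
  have hs : (N : ℝ) + 1 ≤ M := by exact_mod_cast hNM
  have h := integrableOn_eval_mul_rpow_mul_exp p (s := ((M : ℝ) - N - 1) / 2) (c := (M : ℝ) / 2)
    (by linarith) (by linarith)
  refine IntegrableOn.congr_fun
    (h.mul_bdd (g := fun x : ℝ => (t - x) ^ (-(1 / 2) : ℂ))
      (continuous_sub_cpow ht _).aestronglyMeasurable
      (Filter.Eventually.of_forall (norm_sub_cpow_neg_half_le ht)))
    (fun x hx => ?_) measurableSet_Ioi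
  have hx' : (0 : ℝ) < x := hx
  simp only [wC]
  rw [Complex.ofReal_mul, Complex.ofReal_cpow hx'.le, Complex.ofReal_exp]
  have : (((-((M : ℝ) / 2) * x : ℝ)) : ℂ) = -(M : ℂ) * x / 2 := by push_cast; ring
  rw [this]
  ring

/-- The integrand of the skew product, as a function on the plane. -/
noncomputable def skewKernel (M N : ℕ) (t : ℂ) (f g : ℂ[X]) (z : ℝ × ℝ) : ℂ :=
  ((Real.sign (z.1 - z.2) : ℝ) : ℂ) / 2 *
    ((f.eval (z.1 : ℂ) * wC M N t z.1) * (g.eval (z.2 : ℂ) * wC M N t z.2))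

lemma measurable_real_sign : Measurable Real.sign := by
  unfold Real.sign
  exact Measurable.ite measurableSet_Iio measurable_const
    (Measurable.ite measurableSet_Ioi measurable_const measurable_const)

lemma norm_sign_div_two_le (r : ℝ) : ‖((Real.sign r : ℝ) : ℂ) / 2‖ ≤ 1 := by
  rcases Real.sign_apply_eq r with h | h | h <;> rw [h] <;> norm_num

lemma integrable_skewKernel {M N : ℕ} (hNM : N < M) {t : ℂ} (ht : t.im ≠ 0) (f g : ℂ[X]) :
    Integrable (skewKernel M N t f g)
      ((volume.restrict (Ioi (0 : ℝ))).prod (volume.restrict (Ioi (0 : ℝ)))) := by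
  refine Integrable.bdd_mul (c := 1)
    ((integrableOn_eval_mul_wC hNM ht f).mul_prod (integrableOn_eval_mul_wC hNM ht g)) ?_
    (Filter.Eventually.of_forall fun z => norm_sign_div_two_le _)
  have h : Measurable fun z : ℝ × ℝ => Real.sign (z.1 - z.2) :=
    measurable_real_sign.comp (measurable_fst.sub measurable_snd)
  exact ((Complex.measurable_ofReal.comp h).div_const 2).aestronglyMeasurable

lemma skew1_eq_integral_prod {M N : ℕ} (hNM : N < M) {t : ℂ} (ht : t.im ≠ 0) (f g : ℂ[X]) :
    skew1 M N t f g = ∫ z, skewKernel M N t f g z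
      ∂((volume.restrict (Ioi (0 : ℝ))).prod (volume.restrict (Ioi (0 : ℝ)))) := by
  rw [integral_prod _ (integrable_skewKernel hNM ht f g), skew1]
  refine integral_congr_ae (Filter.Eventually.of_forall fun x => ?_)
  refine integral_congr_ae (Filter.Eventually.of_forall fun y => ?_)
  simp only [skewKernel]
  ring

lemma skew1_swap {M N : ℕ} (hNM : N < M) {t : ℂ} (ht : t.im ≠ 0) (f g : ℂ[X]) :
    skew1 M N t g f = -skew1 M N t f g := by
  rw [skew1_eq_integral_prod hNM ht, skew1_eq_integral_prod hNM ht, ← integral_prod_swap,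
    ← integral_neg]
  refine integral_congr_ae (Filter.Eventually.of_forall fun z => ?_)
  simp only [skewKernel, Prod.fst_swap, Prod.snd_swap]
  rw [← neg_sub z.1 z.2, Real.sign_neg]
  push_cast
  ring

lemma skew1_add_left {M N : ℕ} (hNM : N < M) {t : ℂ} (ht : t.im ≠ 0) (f₁ f₂ g : ℂ[X]) :
    skew1 M N t (f₁ + f₂) g = skew1 M N t f₁ g + skew1 M N t f₂ g := by
  simp only [skew1_eq_integral_prod hNM ht]
  rw [← integral_add (integrable_skewKernel hNM ht _ _) (integrable_skewKernel hNM ht _ _)]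
  refine integral_congr_ae (Filter.Eventually.of_forall fun z => ?_)
  simp only [skewKernel, eval_add]
  ring

lemma skew1_smul_left {M N : ℕ} (hNM : N < M) {t : ℂ} (ht : t.im ≠ 0) (a : ℂ) (f g : ℂ[X]) :
    skew1 M N t (a • f) g = a * skew1 M N t f g := by
  simp only [skew1_eq_integral_prod hNM ht]
  rw [← integral_const_mul]
  refine integral_congr_ae (Filter.Eventually.of_forall fun z => ?_)
  simp only [skewKernel, eval_smul, smul_eq_mul]
  ring

lemma inner2C_add_left {M N : ℕ} (hM : 0 < M) (f₁ f₂ g : ℂ[X]) :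
    inner2C M N (f₁ + f₂) g = inner2C M N f₁ g + inner2C M N f₂ g := by
  have h := fun f => integrableOn_eval_mul_w0R (N := N) hM (f * g)
  simp only [eval_mul] at h
  simp only [inner2C]
  rw [← integral_add (h f₁) (h f₂)]
  refine integral_congr_ae (Filter.Eventually.of_forall fun x => ?_)
  simp only [eval_add]
  ring

lemma inner2C_smul_left (M N : ℕ) (a : ℂ) (f g : ℂ[X]) :
    inner2C M N (a • f) g = a * inner2C M N f g := by
  simp only [inner2C]
  rw [← integral_const_mul]
  refine integral_congr_ae (Filter.Eventually.of_forall fun x => ?_)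
  simp only [eval_smul, smul_eq_mul]
  ring

lemma inner2C_comm (M N : ℕ) (f g : ℂ[X]) : inner2C M N f g = inner2C M N g f := by
  simp only [inner2C, mul_comm (f.eval _)]

/-- `inner2C` as a linear map in its first argument. -/
noncomputable def inner2CLin {M : ℕ} (N : ℕ) (hM : 0 < M) (g : ℂ[X]) : ℂ[X] →ₗ[ℂ] ℂ where
  toFun f := inner2C M N f g
  map_add' f₁ f₂ := inner2C_add_left hM f₁ f₂ g
  map_smul' a f := inner2C_smul_left M N a f g

lemma eq_zero_of_inner2C_conj_eq_zero {M N : ℕ} (hM : 0 < M) (p : ℂ[X])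
    (hp : inner2C M N p (p.map (starRingEnd ℂ)) = 0) : p = 0 := by
  by_contra h0
  have hev : ∀ x : ℝ, (p.map (starRingEnd ℂ)).eval (x : ℂ) = (starRingEnd ℂ) (p.eval (x : ℂ)) := by
    intro x
    conv_lhs => rw [← Complex.conj_ofReal x]
    rw [eval_map_apply]
  have hfun : ∀ x : ℝ, p.eval (x : ℂ) * (p.map (starRingEnd ℂ)).eval (x : ℂ) * (w0R M N x : ℂ) =
      ((‖p.eval (x : ℂ)‖ ^ 2 * w0R M N x : ℝ) : ℂ) := by
    intro x
    rw [hev, Complex.mul_conj, Complex.normSq_eq_norm_sq]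
    push_cast
    rfl
  have hintegrable : IntegrableOn (fun x : ℝ => ‖p.eval (x : ℂ)‖ ^ 2 * w0R M N x) (Ioi 0) := by
    have h := integrableOn_eval_mul_w0R (N := N) hM (p * p.map (starRingEnd ℂ))
    simp only [eval_mul, hfun] at h
    exact_mod_cast h.re
  have hw : ∀ x ∈ Ioi (0 : ℝ), 0 < w0R M N x := fun x hx => by
    have : (0 : ℝ) < x := hx
    simp only [w0R]
    positivity
  rw [inner2C] at hp
  simp only [hfun] at hp
  rw [integral_complex_ofReal, Complex.ofReal_eq_zero, setIntegral_eq_zero_iff_of_nonneg_ae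
    ((ae_restrict_iff' measurableSet_Ioi).2 (Filter.Eventually.of_forall fun x hx =>
      mul_nonneg (sq_nonneg _) (hw x hx).le)) hintegrable] at hp
  have hroots : {x : ℝ | p.eval (x : ℂ) = 0}.Finite :=
    (finite_setOfPred_isRoot h0).preimage Complex.ofReal_injective.injOn
  have hne : ∀ᵐ x : ℝ ∂volume.restrict (Ioi 0), p.eval (x : ℂ) ≠ 0 :=
    ae_restrict_of_ae (by
      rw [ae_iff]
      simpa using hroots.measure_zero volume)
  have : (ae (volume.restrict (Ioi (0 : ℝ)))).NeBot := by
    rw [ae_neBot, Ne, Measure.restrict_eq_zero]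
    simp
  obtain ⟨x, ⟨h1, h2⟩, h3⟩ := ((hp.and hne).and (ae_restrict_mem measurableSet_Ioi)).exists
  have h4 := hw x h3
  simp [h2, h4.ne'] at h1

lemma wC_sq {M N : ℕ} (hNM : N < M) {t : ℂ} (ht : t.im ≠ 0) {x : ℝ} (hx : 0 < x) :
    x * (t - x) * wC M N t x * wC M N t x = w0R M N x := by
  have htx : t - x ≠ 0 := Complex.slitPlane_ne_zero (sub_ofReal_mem_slitPlane ht x)
  have hxc : (x : ℂ) ≠ 0 := by exact_mod_cast hx.ne'
  have h1 : (t - x) * ((t - x) ^ (-(1 / 2) : ℂ) * (t - x) ^ (-(1 / 2) : ℂ)) = 1 := by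
    rw [← Complex.cpow_add _ _ htx]
    norm_num [Complex.cpow_neg_one, htx]
  have h2 : (x : ℂ) * ((x : ℂ) ^ (((((M : ℝ) - N - 1) / 2 : ℝ)) : ℂ) *
      (x : ℂ) ^ (((((M : ℝ) - N - 1) / 2 : ℝ)) : ℂ)) = (x : ℂ) ^ (M - N) := by
    rw [← Complex.cpow_add _ _ hxc]
    nth_rw 1 [← Complex.cpow_one (x : ℂ)]
    rw [← Complex.cpow_add _ _ hxc, ← Complex.cpow_natCast, Nat.cast_sub hNM.le]
    push_cast
    ring_nf
  have h3 : Complex.exp (-(M : ℂ) * x / 2) * Complex.exp (-(M : ℂ) * x / 2) =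
      Complex.exp (-(M : ℂ) * x) := by
    rw [← Complex.exp_add]; ring_nf
  simp only [wC, w0R]
  rw [Complex.ofReal_mul, Complex.ofReal_pow, Complex.ofReal_exp, Complex.ofReal_mul,
    Complex.ofReal_neg, Complex.ofReal_natCast, ← h2, ← h3]
  linear_combination (x : ℂ) * (x : ℂ) ^ (((((M : ℝ) - N - 1) / 2 : ℝ)) : ℂ) *
    (x : ℂ) ^ (((((M : ℝ) - N - 1) / 2 : ℝ)) : ℂ) * Complex.exp (-(M : ℂ) * x / 2) *
     Complex.exp (-(M : ℂ) * x / 2) * h1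

lemma hasDerivAt_wC {M N : ℕ} {t : ℂ} (ht : t.im ≠ 0) {x : ℝ} (hx : 0 < x) :
    HasDerivAt (wC M N t)
      (wC M N t x * (-(M : ℂ) / 2 + ((M : ℂ) - N - 1) / 2 / x + 1 / 2 / (t - x))) x := by
  have hs : t - x ∈ Complex.slitPlane := sub_ofReal_mem_slitPlane ht x
  have htx : t - x ≠ 0 := Complex.slitPlane_ne_zero hs
  have hxc : (x : ℂ) ≠ 0 := by exact_mod_cast hx.ne'
  have hid : HasDerivAt (fun z : ℂ => z) 1 (x : ℂ) := hasDerivAt_id _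
  have h1 := ((hid.const_mul (-(M : ℂ))).div_const 2).cexp
  have h2 := hid.cpow_const (c := (((((M : ℝ) - N - 1) / 2 : ℝ)) : ℂ)) (Or.inl (by simpa using hx))
  have h3 := (hid.const_sub t).cpow_const (c := (-(1 / 2) : ℂ)) hs
  have h := ((h1.mul h2).mul h3).comp_ofReal
  refine HasDerivAt.congr_deriv h ?_
  simp only [wC, Pi.mul_apply]
  rw [Complex.cpow_sub _ _ hxc, Complex.cpow_sub _ _ htx, Complex.cpow_one, Complex.cpow_one]
  push_cast
  field_simp

lemma hasDerivAt_mul_wC {M N : ℕ} {t : ℂ} (ht : t.im ≠ 0) (q : ℂ[X]) {x : ℝ} (hx : 0 < x) :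
    HasDerivAt (fun x : ℝ => (q * (X * (C t - X))).eval (x : ℂ) * wC M N t x)
      ((Tq M N t q).eval (x : ℂ) * wC M N t x) x := by
  have htx : t - x ≠ 0 := Complex.slitPlane_ne_zero (sub_ofReal_mem_slitPlane ht x)
  have hxc : (x : ℂ) ≠ 0 := by exact_mod_cast hx.ne'
  have h := ((q * (X * (C t - X))).hasDerivAt (x : ℂ)).comp_ofReal.mul
    (hasDerivAt_wC (M := M) (N := N) ht hx)
  refine h.congr_deriv ?_
  simp only [Tq, derivative_mul, derivative_sub, derivative_C, derivative_X, eval_mul, eval_add,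
    eval_sub, eval_X, eval_C, eval_one, eval_zero, eval_ofNat]
  field_simp
  ring

lemma continuous_mul_wC {M N : ℕ} (hNM : N < M) {t : ℂ} (ht : t.im ≠ 0) :
    Continuous (fun x : ℝ => (x : ℂ) * wC M N t x) := by
  have hs : (N : ℝ) + 1 ≤ M := by exact_mod_cast hNM
  set s : ℝ := ((M : ℝ) - N - 1) / 2 with hsdef
  have hs0 : 0 ≤ s := by rw [hsdef]; linarith
  have h1 : Continuous fun x : ℝ => (x : ℂ) ^ ((s + 1 : ℝ) : ℂ) :=
    Complex.continuous_ofReal_cpow_const (by simp; linarith)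
  have h2 := continuous_sub_cpow ht (-(1 / 2))
  have h3 : Continuous fun x : ℝ => Complex.exp (-(M : ℂ) * x / 2) := by fun_prop
  refine ((h3.mul h1).mul h2).congr fun x => ?_
  have h4 : (x : ℂ) ^ ((s + 1 : ℝ) : ℂ) = x * (x : ℂ) ^ (s : ℂ) := by
    rcases eq_or_ne (x : ℂ) 0 with h | h
    · rw [h, Complex.zero_cpow (by exact_mod_cast (by linarith : s + 1 ≠ 0)), zero_mul]
    · push_cast
      rw [Complex.cpow_add _ _ h, Complex.cpow_one, mul_comm]
  simp only [Pi.mul_apply, h4, wC, ← hsdef]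
  ring

lemma integral_Ioi_Tq {M N : ℕ} (hNM : N < M) {t : ℂ} (ht : t.im ≠ 0) (q : ℂ[X]) {a : ℝ}
    (ha : 0 ≤ a) :
    ∫ y in Ioi a, (Tq M N t q).eval (y : ℂ) * wC M N t y =
      -((q * (X * (C t - X))).eval (a : ℂ) * wC M N t a) := by
  have hderiv : ∀ x ∈ Ioi a, HasDerivAt
      (fun x : ℝ => (q * (X * (C t - X))).eval (x : ℂ) * wC M N t x)
      ((Tq M N t q).eval (x : ℂ) * wC M N t x) x :=
    fun x hx => hasDerivAt_mul_wC ht q (ha.trans_lt hx)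
  have hintegrable := (integrableOn_eval_mul_wC hNM ht (Tq M N t q)).mono_set (Ioi_subset_Ioi ha)
  have hintegrable₀ := (integrableOn_eval_mul_wC hNM ht (q * (X * (C t - X)))).mono_set
    (Ioi_subset_Ioi ha)
  have hcont : Continuous fun x : ℝ => (q * (X * (C t - X))).eval (x : ℂ) * wC M N t x := by
    have h : Continuous fun x : ℝ => (q * (C t - X)).eval (x : ℂ) :=
      (q * (C t - X)).continuous.comp Complex.continuous_ofReal
    refine (h.mul (continuous_mul_wC hNM ht)).congr fun x => ?_
    simp only [Pi.mul_apply, eval_mul, eval_X]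
    ring
  rw [integral_Ioi_of_hasDerivAt_of_tendsto hcont.continuousWithinAt hderiv hintegrable
    (tendsto_zero_of_hasDerivAt_of_integrableOn_Ioi hderiv hintegrable hintegrable₀), zero_sub]

lemma integral_Ioi_sign_mul {g : ℝ → ℂ} (hg : IntegrableOn g (Ioi 0)) {x : ℝ} (hx : 0 < x) :
    ∫ y in Ioi (0 : ℝ), ((Real.sign (x - y) : ℝ) : ℂ) / 2 * g y =
      (∫ y in Ioi 0, g y) / 2 - ∫ y in Ioi x, g y := by
  have hg₁ : IntegrableOn g (Ioc 0 x) := hg.mono_set Ioc_subset_Ioi_self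
  have hg₂ : IntegrableOn g (Ioi x) := hg.mono_set (Ioi_subset_Ioi hx.le)
  have e₁ : (fun y => ((Real.sign (x - y) : ℝ) : ℂ) / 2 * g y) =ᵐ[volume.restrict (Ioc 0 x)]
      fun y => 1 / 2 * g y := by
    rw [← Measure.restrict_congr_set Ioo_ae_eq_Ioc]
    filter_upwards [ae_restrict_mem measurableSet_Ioo] with y hy
    rw [Real.sign_of_pos (sub_pos.2 hy.2), Complex.ofReal_one]
  have e₂ : (fun y => ((Real.sign (x - y) : ℝ) : ℂ) / 2 * g y) =ᵐ[volume.restrict (Ioi x)]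
      fun y => -1 / 2 * g y := by
    filter_upwards [ae_restrict_mem measurableSet_Ioi] with y hy
    rw [Real.sign_of_neg (sub_neg.2 hy), Complex.ofReal_neg, Complex.ofReal_one]
  rw [← Ioc_union_Ioi_eq_Ioi hx.le,
    setIntegral_union (Ioc_disjoint_Ioi le_rfl) measurableSet_Ioi
      (Integrable.congr (hg₁.const_mul _) e₁.symm) (Integrable.congr (hg₂.const_mul _) e₂.symm),
    setIntegral_union (Ioc_disjoint_Ioi le_rfl) measurableSet_Ioi hg₁ hg₂,
    integral_congr_ae e₁, integral_congr_ae e₂, integral_const_mul, integral_const_mul]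
  ring

lemma skew1_Tq_right {M N : ℕ} (hNM : N < M) {t : ℂ} (ht : t.im ≠ 0) (f q : ℂ[X]) :
    skew1 M N t f (Tq M N t q) = inner2C M N f q := by
  rw [skew1, inner2C]
  refine setIntegral_congr_fun measurableSet_Ioi fun x hx => ?_
  have hx' : (0 : ℝ) < x := hx
  have h := integral_Ioi_sign_mul (integrableOn_eval_mul_wC hNM ht (Tq M N t q)) hx'
  rw [integral_Ioi_Tq hNM ht q le_rfl, integral_Ioi_Tq hNM ht q hx'.le] at h
  calc _ = ∫ y in Ioi (0 : ℝ), f.eval (x : ℂ) * wC M N t x *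
        (((Real.sign (x - y) : ℝ) : ℂ) / 2 * ((Tq M N t q).eval (y : ℂ) * wC M N t y)) := by
        refine integral_congr_ae (Filter.Eventually.of_forall fun y => ?_)
        ring
    _ = _ := by
        rw [integral_const_mul, h]
        simp only [← wC_sq hNM ht hx', eval_mul, eval_X, eval_sub, eval_C, Complex.ofReal_zero]
        ring

lemma inner2C_Tq_swap {M N : ℕ} (hNM : N < M) {t : ℂ} (ht : t.im ≠ 0) (p q : ℂ[X]) :
    inner2C M N (Tq M N t q) p = -inner2C M N (Tq M N t p) q := by
  rw [← skew1_Tq_right hNM ht, ← skew1_Tq_right hNM ht, skew1_swap hNM ht]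

/-- `Tq` as a linear map. -/
noncomputable def TqLin (M N : ℕ) (t : ℂ) : ℂ[X] →ₗ[ℂ] ℂ[X] where
  toFun := Tq M N t
  map_add' p q := by simp only [Tq, derivative_add]; ring
  map_smul' a p := by
    simp only [Tq, derivative_smul, RingHom.id_apply, smul_add, mul_smul_comm]

lemma natDegree_Tq_le (M N : ℕ) (t : ℂ) {q : ℂ[X]} {n : ℕ} (hq : q.natDegree ≤ n) :
    (Tq M N t q).natDegree ≤ n + 2 := by
  have hq' : (derivative q).natDegree ≤ n := (natDegree_derivative_le q).trans (by omega)
  rw [add_comm n 2]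
  refine natDegree_add_le_of_degree_le (natDegree_mul_le_of_le ?_ hq')
    (natDegree_mul_le_of_le ?_ hq) <;> compute_degree

lemma inner2C_eq_zero_of_forall_X_pow {M N : ℕ} (hM : 0 < M) {f p : ℂ[X]} {n : ℕ}
    (hf : ∀ j, j < n → inner2C M N f (X ^ j) = 0) (hp : p.natDegree < n) :
    inner2C M N f p = 0 := by
  rw [inner2C_comm]
  change inner2CLin N hM f p = 0
  rw [as_sum_range' p n hp, map_sum]
  refine Finset.sum_eq_zero fun j hj => ?_
  rw [← C_mul_X_pow_eq_monomial, ← smul_eq_C_mul, map_smul]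
  change _ • inner2C M N (X ^ j) f = 0
  rw [inner2C_comm, hf j (Finset.mem_range.1 hj), smul_zero]

/-- A skew-symmetric matrix of odd size is singular. -/
lemma Matrix.det_eq_zero_of_transpose_eq_neg {n : ℕ} (hn : Odd n) (A : Matrix (Fin n) (Fin n) ℂ)
    (hA : A.transpose = -A) : A.det = 0 := by
  have h := A.det_transpose
  rw [hA, Matrix.det_neg, Fintype.card_fin, hn.neg_one_pow] at h
  linear_combination -(1 / 2) * h

lemma exists_Tq_orthogonal {M N : ℕ} (hNM : N < M) {t : ℂ} (ht : t.im ≠ 0) {n : ℕ} (hn : Odd n) :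
    ∃ q : ℂ[X], q ≠ 0 ∧ q.natDegree < n ∧
      ∀ j, j < n → inner2C M N (Tq M N t q) (X ^ j) = 0 := by
  have hM : 0 < M := (Nat.zero_le N).trans_lt hNM
  let A : Matrix (Fin n) (Fin n) ℂ :=
    Matrix.of fun i j => inner2C M N (Tq M N t (X ^ (i : ℕ))) (X ^ (j : ℕ))
  have hA : A.transpose = -A := by
    ext i j
    exact inner2C_Tq_swap hNM ht _ _
  obtain ⟨v, hv0, hv⟩ :=
    Matrix.exists_vecMul_eq_zero_iff.2 (Matrix.det_eq_zero_of_transpose_eq_neg hn A hA)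
  have hcoeff : ∀ i : Fin n, (∑ l, v l • (X : ℂ[X]) ^ (l : ℕ)).coeff i = v i := by
    intro i
    simp [coeff_X_pow, Fin.val_inj]
  refine ⟨∑ i, v i • (X : ℂ[X]) ^ (i : ℕ), ?_, ?_, ?_⟩
  · intro h
    apply hv0
    ext i
    rw [← hcoeff i, h, coeff_zero, Pi.zero_apply]
  · refine Nat.lt_of_le_pred hn.pos (natDegree_sum_le_of_forall_le _ _ fun i _ => ?_)
    refine (natDegree_smul_le _ _).trans ?_
    rw [natDegree_X_pow]
    exact Nat.le_pred_of_lt i.2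
  · intro j hj
    have h := congrFun hv ⟨j, hj⟩
    change inner2CLin N hM (X ^ j) (TqLin M N t (∑ i, v i • (X : ℂ[X]) ^ (i : ℕ))) = 0
    rw [map_sum, map_sum]
    simp only [map_smul]
    exact h

lemma eq_zero_of_forall_inner2C_X_pow {M N : ℕ} (hM : 0 < M) {p : ℂ[X]} {n : ℕ}
    (hp : p.degree < n) (h : ∀ j, j < n → inner2C M N p (X ^ j) = 0) : p = 0 := by
  by_contra h0
  refine h0 (eq_zero_of_inner2C_conj_eq_zero (N := N) hM p
    (inner2C_eq_zero_of_forall_X_pow hM h ?_))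
  exact (natDegree_map_le).trans_lt ((natDegree_lt_iff_degree_lt h0).2 hp)

lemma degree_sub_smul_lt {L p : ℂ[X]} {n : ℕ} (hL : L.Monic) (hLn : L.natDegree = n)
    (hp : p.degree < (n + 1 : ℕ)) : (p - p.coeff n • L).degree < n := by
  rw [degree_lt_iff_coeff_zero]
  intro m hm
  rw [coeff_sub, coeff_smul, smul_eq_mul]
  rcases hm.eq_or_lt with rfl | hm
  · have : L.coeff n = 1 := by rw [← hLn]; exact hL
    rw [this, mul_one, sub_self]
  · rw [(degree_lt_iff_coeff_zero _ _).1 hp m hm,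
      coeff_eq_zero_of_natDegree_lt (p := L) (hLn ▸ hm), mul_zero, sub_zero]

lemma IsLag.inner2C_eq_zero {M N : ℕ} (hM : 0 < M) {L : ℕ → ℂ[X]} (hL : IsLag M N L) {n : ℕ}
    {p : ℂ[X]} (hp : p.natDegree < n) : inner2C M N (L n) p = 0 :=
  inner2C_eq_zero_of_forall_X_pow hM (hL n).2.2 hp

lemma IsLag.exists_eq_smul_add_smul {M N : ℕ} (hM : 0 < M) {L : ℕ → ℂ[X]} (hL : IsLag M N L)
    {n : ℕ} {p : ℂ[X]} (hp : p.natDegree ≤ n + 1)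
    (h : ∀ j, j < n → inner2C M N p (X ^ j) = 0) :
    ∃ a b : ℂ, p = a • L (n + 1) + b • L n := by
  have h₁ := degree_sub_smul_lt (hL (n + 1)).1 (hL (n + 1)).2.1
    ((degree_le_of_natDegree_le hp).trans_lt (by exact_mod_cast (n + 1).lt_succ_self))
  set p₁ := p - p.coeff (n + 1) • L (n + 1) with hp₁
  have h₂ := degree_sub_smul_lt (hL n).1 (hL n).2.1 h₁
  have h₃ := eq_zero_of_forall_inner2C_X_pow (N := N) hM h₂ fun j hj => by
    have e : ∀ m, j < m → inner2CLin N hM (X ^ j) (L m) = 0 := fun m hm => (hL m).2.2 j hm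
    have e' : inner2CLin N hM (X ^ j) p = 0 := h j hj
    change inner2CLin N hM (X ^ j) _ = 0
    rw [hp₁, map_sub, map_sub, map_smul, map_smul, e n hj, e (n + 1) (by omega), e']
    simp
  refine ⟨p.coeff (n + 1), p₁.coeff n, ?_⟩
  rw [sub_eq_zero, hp₁] at h₃
  rw [← h₃]
  abel

/-- For every even integer `k ≥ 2`, `⟨L_k, L_{k−1}⟩₁ = 0`. -/
theorem stmt_7 (M N : ℕ) (hN : 0 < N) (hNM : N < M) (t : ℂ) (ht : t.im ≠ 0)
    (L : ℕ → Polynomial ℂ) (hL : IsLag M N L)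
    (k : ℕ) (hk : 2 ≤ k) (hke : Even k) :
    skew1 M N t (L k) (L (k - 1)) = 0 := by
  have hM : 0 < M := hN.trans hNM
  obtain ⟨n, rfl⟩ : ∃ n, k = n + 1 := ⟨k - 1, by omega⟩
  rw [Nat.add_sub_cancel]
  obtain ⟨q, hq0, hqn, hq⟩ :=
    exists_Tq_orthogonal hNM ht (n := n) (by rcases hke with ⟨m, hm⟩; exact ⟨m - 1, by omega⟩)
  have hdeg : (Tq M N t q).natDegree ≤ n + 1 :=
    (natDegree_Tq_le M N t (Nat.le_pred_of_lt hqn)).trans (by rw [Nat.pred_eq_sub_one]; omega)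
  obtain ⟨a, b, hab⟩ := hL.exists_eq_smul_add_smul hM hdeg hq
  -- Pair `Tq q` with `L n` on the left, and `L (n + 1)` with `Tq q` on the right.
  have h₁ : a * skew1 M N t (L (n + 1)) (L n) = 0 := by
    have h := skew1_swap hNM ht (L n) (Tq M N t q)
    have hs := skew1_swap hNM ht (L n) (L n)
    rw [skew1_Tq_right hNM ht, hL.inner2C_eq_zero hM hqn, hab, skew1_add_left hNM ht,
      skew1_smul_left hNM ht, skew1_smul_left hNM ht] at h
    linear_combination h - b / 2 * hs
  have h₂ : b * skew1 M N t (L (n + 1)) (L n) = 0 := by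
    have h := skew1_swap hNM ht (L (n + 1)) (Tq M N t q)
    have hs := skew1_swap hNM ht (L (n + 1)) (L (n + 1))
    rw [skew1_Tq_right hNM ht, hL.inner2C_eq_zero hM (hqn.trans n.lt_succ_self), hab,
      skew1_add_left hNM ht, skew1_smul_left hNM ht, skew1_smul_left hNM ht,
      skew1_swap hNM ht (L (n + 1)) (L n)] at h
    linear_combination -h + a / 2 * hs
  by_contra hne
  have ha : a = 0 := (mul_eq_zero.1 h₁).resolve_right hne
  have hb : b = 0 := (mul_eq_zero.1 h₂).resolve_right hne
  have hT : Tq M N t q = 0 := by rw [hab, ha, hb, zero_smul, zero_smul, add_zero]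
  refine hq0 (eq_zero_of_inner2C_conj_eq_zero (N := N) hM q ?_)
  rw [inner2C_comm, ← skew1_Tq_right hNM ht, hT]
  simp [skew1]
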